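/- Let q_{n+1} ≥ 1, and let φ: T_h → C be a 1-periodic function holomorphic in the strip |Im z| < h with sup norm ‖φ‖_h ≤ M, such that ‖φ(·+α) − φ(·)‖_h ≤ ε, where α is irrational with ‖kα‖_{R/Z} ≥ 1/(2q_{n+1}) for all integers 0 < |k| < q_{n+1}. Then for any 0 < h' < h, the deviation from its mean satisfies ‖φ − ∫₀¹ φ(x)dx‖_{h'} ≤ C·(1 − e^{−2π(h−h')})^{-1}·( q_{n+1}·ε + M·e^{−2π q_{n+1}(h−h')} ) for an absolute constant C. -/

import Mathlib

open Complex Real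

/-- Distance from a real number to the nearest integer (`‖x‖_{ℝ/ℤ}`). -/
noncomputable def distToInt (x : ℝ) : ℝ := |x - round x|

/-- Horizontal integrals of a 1-periodic holomorphic function do not depend on the height. -/
lemma strip_shift (h : ℝ) (F : ℂ → ℂ)
    (hd : DifferentiableOn ℂ F {z : ℂ | |z.im| < h})
    (hp : ∀ z : ℂ, |z.im| < h → F (z + 1) = F z) (y : ℝ) (hy : |y| < h) :
    ∫ x in (0:ℝ)..1, F (x + y * I) = ∫ x in (0:ℝ)..1, F x := by
  have key := Complex.integral_boundary_rect_eq_zero_of_differentiableOn F (0 : ℂ) (1 + y * I)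
    (hd.mono ?_)
  · have e : ∫ t in (0:ℝ)..y, F (1 + t * I) = ∫ t in (0:ℝ)..y, F (t * I) := by
      apply intervalIntegral.integral_congr
      intro t ht
      have ht' : |t| < h := by
        have := Set.abs_sub_left_of_mem_uIcc ht
        simp only [sub_zero] at this
        exact this.trans_lt hy
      have := hp (t * I) (by simpa using ht')
      simpa [add_comm] using this
    simp at key
    rw [e] at key
    linear_combination -key
  · intro z hz
    have h2 : z.im ∈ Set.uIcc 0 y := by simpa using hz.2
    have := Set.abs_sub_left_of_mem_uIcc h2
    simp only [sub_zero] at this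
    exact this.trans_lt hy

lemma exp_per (k : ℤ) (z : ℂ) :
    Complex.exp (-(2 * π * I * k * (z + 1))) = Complex.exp (-(2 * π * I * k * z)) := by
  rw [Complex.exp_eq_exp_iff_exists_int]
  exact ⟨-k, by push_cast; ring⟩

lemma coef_shift (h : ℝ) (F : ℂ → ℂ)
    (hd : DifferentiableOn ℂ F {z : ℂ | |z.im| < h})
    (hp : ∀ z : ℂ, |z.im| < h → F (z + 1) = F z) (y : ℝ) (hy : |y| < h) (k : ℤ) :
    ∫ x in (0:ℝ)..1, F (x + y * I) * Complex.exp (-(2 * π * I * k * (x + y * I))) =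
      ∫ x in (0:ℝ)..1, F x * Complex.exp (-(2 * π * I * k * x)) := by
  refine strip_shift h (fun z => F z * Complex.exp (-(2 * π * I * k * z))) ?_ ?_ y hy
  · exact hd.mul (Differentiable.differentiableOn (by fun_prop))
  · intro z hz
    simp only [hp z hz, exp_per]

lemma norm_E (k : ℤ) (x y : ℝ) :
    ‖Complex.exp (-(2 * π * I * k * (x + y * I)))‖ = Real.exp (2 * π * k * y) := by
  rw [Complex.norm_exp]; congr 1; simp

lemma coef_bound (h : ℝ) (hh : 0 < h) (F : ℂ → ℂ) (M : ℝ)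
    (hd : DifferentiableOn ℂ F {z : ℂ | |z.im| < h})
    (hp : ∀ z : ℂ, |z.im| < h → F (z + 1) = F z)
    (hM : ∀ z : ℂ, |z.im| < h → ‖F z‖ ≤ M) (k : ℤ) :
    ‖∫ x in (0:ℝ)..1, F x * Complex.exp (-(2 * π * I * k * x))‖ ≤
      M * Real.exp (-2 * π * |(k:ℝ)| * h) := by
  have h1 : ∀ y : ℝ, |y| < h → ‖∫ x in (0:ℝ)..1, F x * Complex.exp (-(2 * π * I * k * x))‖ ≤
      M * Real.exp (2 * π * k * y) := by
    intro y hy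
    rw [← coef_shift h F hd hp y hy k]
    have := intervalIntegral.norm_integral_le_of_norm_le_const (a := (0:ℝ)) (b := 1)
      (C := M * Real.exp (2 * π * k * y))
      (f := fun x : ℝ => F (x + y * I) * Complex.exp (-(2 * π * I * k * (x + y * I)))) ?_
    · simpa using this
    · intro x _
      rw [norm_mul, norm_E]
      gcongr
      exact hM _ (by simpa using hy)
  have h2 : ∀ t ∈ Set.Ioo 0 h, ‖∫ x in (0:ℝ)..1, F x * Complex.exp (-(2 * π * I * k * x))‖ ≤
      M * Real.exp (-2 * π * |(k:ℝ)| * t) := by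
    intro t ht
    rcases le_total 0 (k:ℝ) with hk | hk
    · have := h1 (-t) (by rw [abs_neg, abs_of_pos ht.1]; exact ht.2)
      rw [abs_of_nonneg hk]
      convert this using 3
      ring
    · have := h1 t (by rw [abs_of_pos ht.1]; exact ht.2)
      rw [abs_of_nonpos hk]
      convert this using 3
      ring
  have hc : Filter.Tendsto (fun t : ℝ => M * Real.exp (-2 * π * |(k:ℝ)| * t))
      (nhdsWithin h (Set.Iio h)) (nhds (M * Real.exp (-2 * π * |(k:ℝ)| * h))) :=
    (Continuous.tendsto (by fun_prop) h).mono_left nhdsWithin_le_nhds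
  exact ge_of_tendsto hc (Filter.eventually_of_mem (Ioo_mem_nhdsLT hh) h2)

lemma cont_line (h : ℝ) (F : ℂ → ℂ)
    (hd : DifferentiableOn ℂ F {z : ℂ | |z.im| < h}) (y : ℝ) (hy : |y| < h) :
    Continuous (fun x : ℝ => F (x + y * I)) :=
  hd.continuousOn.comp_continuous (by fun_prop) (by intro x; simpa using hy)

lemma coef_trans (h : ℝ) (hh : 0 < h) (F : ℂ → ℂ)
    (hd : DifferentiableOn ℂ F {z : ℂ | |z.im| < h})
    (hp : ∀ z : ℂ, |z.im| < h → F (z + 1) = F z) (α : ℝ) (k : ℤ) :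
    ∫ x in (0:ℝ)..1, (F (x + α) - F x) * Complex.exp (-(2 * π * I * k * x)) =
      (Complex.exp (I * ((2 * π * (k * α) : ℝ))) - 1) *
        ∫ x in (0:ℝ)..1, F x * Complex.exp (-(2 * π * I * k * x)) := by
  have c0 : Continuous (fun x : ℝ => F x) := by
    simpa using cont_line h F hd 0 (by simpa using hh)
  have c1 : Continuous (fun x : ℝ => F (x + α)) := by
    have := c0.comp (continuous_add_const α)
    simpa [Function.comp_def] using this
  set G : ℝ → ℂ := fun x => F x * Complex.exp (-(2 * π * I * k * x)) with hG
  have hper : Function.Periodic G 1 := by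
    intro x
    simp only [hG]
    push_cast
    rw [exp_per, hp _ (by simpa using hh)]
  have e1 : ∫ x in (0:ℝ)..1, F (x + α) * Complex.exp (-(2 * π * I * k * x)) =
      Complex.exp (I * ((2 * π * (k * α) : ℝ))) * ∫ x in (0:ℝ)..1, G x := by
    have : ∫ x in (0:ℝ)..1, G (x + α) = ∫ x in (0:ℝ)..1, G x := by
      rw [intervalIntegral.integral_comp_add_right]
      have := hper.intervalIntegral_add_eq α 0
      simpa [add_comm] using this
    rw [← this, ← intervalIntegral.integral_const_mul]
    apply intervalIntegral.integral_congr
    intro x _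
    simp only [hG]
    push_cast
    rw [mul_left_comm, ← Complex.exp_add]
    congr 2
    ring
  rw [sub_mul, one_mul, ← e1, ← intervalIntegral.integral_sub]
  · simp only [hG, sub_mul]
  · exact (c1.mul (by fun_prop)).intervalIntegrable _ _
  · exact (c0.mul (by fun_prop)).intervalIntegrable _ _

lemma strip_small_div (x : ℝ) : 4 * distToInt x ≤ ‖Complex.exp (I * ((2 * π * x : ℝ))) - 1‖ := by
  rw [Complex.norm_exp_I_mul_ofReal_sub_one]
  have e : 2 * π * x / 2 = π * (x - round x) + round x * π := by ring
  rw [e, Real.norm_eq_abs, abs_mul, Real.sin_add_int_mul_pi]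
  have hb := abs_sub_round x
  have := Real.mul_abs_le_abs_sin (x := π * (x - round x)) (by
    rw [abs_mul, abs_of_pos Real.pi_pos]; nlinarith [Real.pi_pos])
  rw [abs_mul, abs_of_pos Real.pi_pos] at this
  have e2 : 2 / π * (π * |x - round x|) = 2 * |x - round x| := by
    field_simp
  have e3 : |(-1 : ℝ) ^ (round x) * Real.sin (π * (x - round x))| =
      |Real.sin (π * (x - round x))| := by
    rw [abs_mul, abs_zpow]; simp
  rw [e3, abs_two, distToInt]
  linarith

/-- The majorant series. -/
lemma majorant (A M r : ℝ) (q : ℕ) (r0 : 0 < r) (r1 : r < 1) :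
    HasSum (fun k : ℤ => A * r ^ k.natAbs + if q ≤ k.natAbs then M * r ^ k.natAbs else 0)
      (2 * ((1 - r)⁻¹ * (A + M * r ^ q)) - (A + if q ≤ 0 then M else 0)) := by
  have h1 : HasSum (fun n : ℕ => A * r ^ n) (A * (1 - r)⁻¹) :=
    (hasSum_geometric_of_lt_one r0.le r1).mul_left A
  have h2 : HasSum (fun n : ℕ => if q ≤ n then M * r ^ n else 0) (M * r ^ q * (1 - r)⁻¹) := by
    rw [← hasSum_nat_add_iff' q]
    have : ∑ i ∈ Finset.range q, (if q ≤ i then M * r ^ i else 0) = 0 := by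
      apply Finset.sum_eq_zero
      intro i hi
      rw [if_neg (by simpa using hi)]
    rw [this, sub_zero]
    have e : (fun n : ℕ => if q ≤ n + q then M * r ^ (n + q) else 0) =
        fun n : ℕ => M * r ^ q * r ^ n := by
      funext n
      rw [if_pos (by omega)]; ring
    rw [e]
    exact (hasSum_geometric_of_lt_one r0.le r1).mul_left (M * r ^ q)
  have h3 := h1.add h2
  have h4 := HasSum.of_nat_of_neg (f := fun k : ℤ => A * r ^ k.natAbs +
    if q ≤ k.natAbs then M * r ^ k.natAbs else 0) (by simpa using h3) (by simpa using h3)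
  have e : 2 * ((1 - r)⁻¹ * (A + M * r ^ q)) - (A + if q ≤ 0 then M else 0) =
      (A * (1 - r)⁻¹ + M * r ^ q * (1 - r)⁻¹) + (A * (1 - r)⁻¹ + M * r ^ q * (1 - r)⁻¹) -
      (A * r ^ (0:ℤ).natAbs + if q ≤ (0:ℤ).natAbs then M * r ^ (0:ℤ).natAbs else 0) := by
    simp only [Int.natAbs_zero, pow_zero, mul_one]
    ring
  rw [e]
  exact h4

lemma exp_abs_pow (k : ℤ) (d : ℝ) :
    Real.exp (-2 * π * |(k:ℝ)| * d) = Real.exp (-2 * π * d) ^ k.natAbs := by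
  rw [← Real.exp_nat_mul, Nat.cast_natAbs]; push_cast; congr 1; ring

lemma fourier_exp (h : ℝ) (hh : 0 < h) (F : ℂ → ℂ) (M : ℝ)
    (hd : DifferentiableOn ℂ F {z : ℂ | |z.im| < h})
    (hp : ∀ z : ℂ, |z.im| < h → F (z + 1) = F z)
    (hM : ∀ z : ℂ, |z.im| < h → ‖F z‖ ≤ M) (z : ℂ) (hz : |z.im| < h) :
    HasSum (fun k : ℤ => (∫ x in (0:ℝ)..1, F x * Complex.exp (-(2 * π * I * k * x))) *
      Complex.exp (2 * π * I * k * z)) (F z) := by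
  have hper : Function.Periodic (fun x : ℝ => F (x + z.im * I)) 1 := by
    intro x
    have := hp (x + z.im * I) (by simpa using hz)
    simp only
    rw [← this]; push_cast; ring_nf
  haveI : Fact (0 < (1:ℝ)) := ⟨one_pos⟩
  let f : C(AddCircle (1:ℝ), ℂ) := ⟨hper.lift, (cont_line h F hd z.im hz).quotient_lift _⟩
  have hf : ∀ x : ℝ, f (x : AddCircle (1:ℝ)) = F (x + z.im * I) := fun x => rfl
  have hcoef : ∀ k : ℤ, fourierCoeff f k =
      (∫ x in (0:ℝ)..1, F x * Complex.exp (-(2 * π * I * k * x))) * Complex.exp (2 * π * I * k * (z.im * I)) := by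
    intro k
    rw [fourierCoeff_eq_intervalIntegral f k 0, ← coef_shift h F hd hp z.im hz k,
      ← intervalIntegral.integral_mul_const]
    simp only [one_div, inv_one, one_smul, zero_add]
    apply intervalIntegral.integral_congr
    intro x _
    simp only [fourier_coe_apply, hf, smul_eq_mul]
    rw [mul_assoc (F _), ← Complex.exp_add, mul_comm]
    congr 2
    push_cast
    ring
  have hs : Summable (fourierCoeff f) := by
    have r1 : Real.exp (-2 * π * (h - |z.im|)) < 1 := by
      rw [Real.exp_lt_one_iff]; nlinarith [Real.pi_pos]
    refine Summable.of_norm_bounded (majorant M 0 _ 0 (Real.exp_pos _) r1).summable ?_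
    intro k
    rw [hcoef, norm_mul]
    have b1 := coef_bound h hh F M hd hp hM k
    have hM0 : 0 ≤ M := (norm_nonneg _).trans (hM z hz)
    have b2 : ‖Complex.exp (2 * π * I * k * (z.im * I))‖ ≤ Real.exp (2 * π * |(k:ℝ)| * |z.im|) := by
      rw [Complex.norm_exp]
      apply Real.exp_le_exp.mpr
      have : (2 * π * I * k * (z.im * I) : ℂ).re = 2 * π * -(k * z.im) := by simp; ring
      rw [this, mul_assoc (2 * π), ← abs_mul]
      gcongr
      exact neg_le_abs _
    calc _ ≤ (M * Real.exp (-2 * π * |(k:ℝ)| * h)) * Real.exp (2 * π * |(k:ℝ)| * |z.im|) := by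
          gcongr
      _ = M * Real.exp (-2 * π * |(k:ℝ)| * (h - |z.im|)) := by
          rw [mul_assoc, ← Real.exp_add]; congr 2; ring
      _ ≤ _ := by rw [exp_abs_pow]; simp
  have := has_pointwise_sum_fourier_series_of_summable hs (z.re : AddCircle (1:ℝ))
  rw [hf, Complex.re_add_im] at this
  convert this using 2 with k
  rw [hcoef, fourier_coe_apply, smul_eq_mul, mul_assoc (∫ x in (0:ℝ)..1, _),
    ← Complex.exp_add]
  congr 2
  conv_lhs => rw [← Complex.re_add_im z]
  push_cast
  ring

/-- Quantitative decay of the deviation from the mean, for a 1-periodic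
holomorphic function `φ` on the strip `|Im z| < h` which is bounded by `M` and
almost invariant (up to `ε`) under translation by a Diophantine-at-scale-`q`
irrational `α`: on any smaller strip `|Im z| < h'`, one has
`‖φ − ∫₀¹ φ‖_{h'} ≤ C (1 − e^{−2π(h−h')})⁻¹ (q ε + M e^{−2π q (h−h')})`
for an absolute constant `C`. -/
theorem strip_mean_deviation_estimate :
    ∃ C : ℝ, 0 < C ∧
      ∀ (h h' M ε α : ℝ) (q : ℕ) (φ : ℂ → ℂ),
        0 < h' → h' < h → 0 ≤ M → 0 ≤ ε → 1 ≤ q →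
        Irrational α →
        DifferentiableOn ℂ φ {z : ℂ | |z.im| < h} →
        (∀ z : ℂ, |z.im| < h → φ (z + 1) = φ z) →
        (∀ z : ℂ, |z.im| < h → ‖φ z‖ ≤ M) →
        (∀ z : ℂ, |z.im| < h → ‖φ (z + α) - φ z‖ ≤ ε) →
        (∀ k : ℤ, k ≠ 0 → |k| < (q : ℤ) → distToInt (k * α) ≥ 1 / (2 * q)) →
        ∀ z : ℂ, |z.im| < h' →
          ‖φ z - ∫ x in (0:ℝ)..1, φ x‖ ≤
            C * (1 - Real.exp (-2 * π * (h - h')))⁻¹ *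
              (q * ε + M * Real.exp (-2 * π * q * (h - h'))) := by
  refine ⟨2, two_pos, ?_⟩
  intro h h' M ε α q φ hh' hlt hM0 hε hq _ hd hp hM hinv hdio z hz
  have hh : 0 < h := hh'.trans hlt
  have hzh : |z.im| < h := hz.trans hlt
  set r := Real.exp (-2 * π * (h - h')) with hr
  have r1 : r < 1 := by
    rw [hr, Real.exp_lt_one_iff]; nlinarith [Real.pi_pos]
  have r0 : 0 < r := Real.exp_pos _
  have hq0 : (0:ℝ) < q := by exact_mod_cast hq
  have hA : 0 ≤ (q:ℝ) * ε := by positivity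
  have hsum := hasSum_ite_sub_hasSum (fourier_exp h hh φ M hd hp hM z hzh) 0
  have hmaj := majorant (q * ε) M r q r0 r1
  have e0 : (∫ x in (0:ℝ)..1, φ x * Complex.exp (-(2 * π * I * ((0:ℤ):ℂ) * x))) *
      Complex.exp (2 * π * I * ((0:ℤ):ℂ) * z) = ∫ x in (0:ℝ)..1, φ x := by simp
  rw [e0] at hsum
  have hrq : Real.exp (-2 * π * q * (h - h')) = r ^ q := by
    rw [hr, ← Real.exp_nat_mul]; congr 1; ring
  have fin := hsum.norm_le_of_bounded hmaj ?_
  · rw [hrq]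
    rw [if_neg (by omega)] at fin
    linarith
  intro k
  by_cases hk : k = 0
  · rw [if_pos hk, norm_zero]
    split_ifs <;> positivity
  rw [if_neg hk, norm_mul]
  have b2 : ‖Complex.exp (2 * π * I * k * z)‖ ≤ Real.exp (2 * π * |(k:ℝ)| * h') := by
    rw [Complex.norm_exp]
    apply Real.exp_le_exp.mpr
    have : (2 * π * I * k * z : ℂ).re = 2 * π * -(k * z.im) := by simp; ring
    rw [this, mul_assoc (2 * π)]
    gcongr
    calc _ ≤ |(k:ℝ) * z.im| := neg_le_abs _
      _ ≤ _ := by rw [abs_mul]; gcongr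
  have comb : ∀ B : ℝ, 0 ≤ B →
      ‖∫ x in (0:ℝ)..1, φ x * Complex.exp (-(2 * π * I * k * x))‖ ≤
        B * Real.exp (-2 * π * |(k:ℝ)| * h) →
      ‖∫ x in (0:ℝ)..1, φ x * Complex.exp (-(2 * π * I * k * x))‖ * ‖Complex.exp (2 * π * I * k * z)‖ ≤
        B * r ^ k.natAbs := by
    intro B hB hb
    calc _ ≤ (B * Real.exp (-2 * π * |(k:ℝ)| * h)) * Real.exp (2 * π * |(k:ℝ)| * h') := by
          gcongr
      _ = B * Real.exp (-2 * π * |(k:ℝ)| * (h - h')) := by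
          rw [mul_assoc, ← Real.exp_add]; congr 2; ring
      _ = _ := by rw [exp_abs_pow]
  by_cases hkq : q ≤ k.natAbs
  · rw [if_pos hkq]
    have := comb M hM0 (coef_bound h hh φ M hd hp hM k)
    have : 0 ≤ q * ε * r ^ k.natAbs := by positivity
    linarith
  · rw [if_neg hkq, add_zero]
    apply comb _ hA
    have him : ∀ w : ℂ, (w + α).im = w.im := by intro w; simp
    have bd := coef_bound h hh (fun w => φ (w + α) - φ w) ε
      ((hd.comp (Differentiable.differentiableOn (by fun_prop))
        (by intro w hw; simpa using hw)).sub hd)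
      (by
        intro w hw
        rw [hp w hw, ← hp (w + α) (by rw [him]; exact hw)]
        ring_nf) hinv k
    rw [coef_trans h hh φ hd hp α k, norm_mul] at bd
    have sd := strip_small_div (k * α)
    have hdi := hdio k hk (by rw [Int.abs_eq_natAbs]; omega)
    have low : 1 / (q:ℝ) ≤ ‖Complex.exp (I * ((2 * π * (k * α) : ℝ))) - 1‖ := by
      have : 1 / (q:ℝ) = 2 * (1 / (2 * q)) := by field_simp
      have : 0 ≤ 1 / (2 * (q:ℝ)) := by positivity
      linarith
    set X := ‖∫ x in (0:ℝ)..1, φ x * Complex.exp (-(2 * π * I * k * x))‖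
    have hX : 0 ≤ X := norm_nonneg _
    have : 1 / (q:ℝ) * X ≤ ε * Real.exp (-2 * π * |(k:ℝ)| * h) :=
      (mul_le_mul_of_nonneg_right low hX).trans bd
    calc X = q * (1 / (q:ℝ) * X) := by field_simp
      _ ≤ q * (ε * Real.exp (-2 * π * |(k:ℝ)| * h)) := by gcongr
      _ = _ := by ring
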